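/- Let q, r be positive integers and let f₁,…,f_q : 𝔹ⁿ → ℂ and g₁,…,g_r : 𝔹ⁿ → ℂ be holomorphic functions such that (f₁,…,f_q) is linearly independent and (g₁,…,g_r) is linearly independent (as functions on 𝔹ⁿ). If u ∈ ℂ^{q×r} satisfies Σ_{j=1}^{r} Σ_{i=1}^{q} u_{ij} f_i(z) conj(g_j(z)) = 0 for every z ∈ 𝔹ⁿ, then u_{ij} = 0 for all i, j. -/

import Mathlib

open Complex

noncomputable section

/-- The open unit ball in ℂⁿ. -/
def UnitBall (n : ℕ) : Set (Fin n → ℂ) := {z | ∑ i, ‖z i‖ ^ 2 < 1}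

theorem isOpen_unitBall (n : ℕ) : IsOpen (UnitBall n) :=
  isOpen_lt (by fun_prop) continuous_const

theorem convex_unitBall (n : ℕ) : Convex ℝ (UnitBall n) := by
  have h : UnitBall n =
      (WithLp.linearEquiv 2 ℝ (Fin n → ℂ)).symm ⁻¹' Metric.ball (0 : EuclideanSpace ℂ (Fin n)) 1 := by
    ext z
    simp [UnitBall, EuclideanSpace.norm_eq, Real.sqrt_lt' one_pos]
  rw [h]
  exact (convex_ball _ _).linear_preimage (WithLp.linearEquiv 2 ℝ (Fin n → ℂ)).symm.toLinearMap

/-- A holomorphic function on a convex open set containing the origin that vanishes at the real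
points of the set vanishes identically. -/
theorem eqOn_zero_of_eq_zero_on_real {S : Set ℂ} (hSo : IsOpen S) (hSc : Convex ℝ S)
    (h0 : (0 : ℂ) ∈ S) {h : ℂ → ℂ} (hd : DifferentiableOn ℂ h S)
    (hz : ∀ t : ℝ, (t : ℂ) ∈ S → h t = 0) : Set.EqOn h 0 S := by
  refine (hd.analyticOnNhd hSo).eqOn_zero_of_preconnected_of_frequently_eq_zero
    hSc.isPreconnected h0 ?_
  have ht : Filter.Tendsto (fun t : ℝ => (t : ℂ)) (nhdsWithin 0 {0}ᶜ) (nhdsWithin 0 {0}ᶜ) := by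
    refine tendsto_nhdsWithin_iff.2 ⟨?_, ?_⟩
    · exact (Complex.continuous_ofReal.tendsto' 0 0 (by simp)).mono_left nhdsWithin_le_nhds
    · filter_upwards [self_mem_nhdsWithin] with t ht
      simpa using ht
  refine ht.frequently (Filter.Eventually.frequently ?_)
  filter_upwards [ht (nhdsWithin_le_nhds (hSo.mem_nhds h0))] with t hts
  exact hz t hts

/-- If a sesquilinear combination of holomorphic functions on a convex open set vanishes on the
diagonal, then its polarization vanishes. -/
theorem polarization_eq_zero {E ι κ : Type*} [NormedAddCommGroup E] [NormedSpace ℂ E]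
    [Fintype ι] [Fintype κ] {B : Set E} (hBo : IsOpen B) (hBc : Convex ℝ B)
    {f : ι → E → ℂ} {g : κ → E → ℂ}
    (hf : ∀ i, DifferentiableOn ℂ (f i) B) (hg : ∀ j, DifferentiableOn ℂ (g j) B)
    (u : ι → κ → ℂ)
    (hu : ∀ z ∈ B, ∑ j, ∑ i, u i j * f i z * (starRingEnd ℂ) (g j z) = 0)
    {a b : E} (ha : a ∈ B) (hb : b ∈ B) :
    ∑ j, ∑ i, u i j * f i a * (starRingEnd ℂ) (g j b) = 0 := by
  set c : E := (1 / 2 : ℂ) • (a + b) with hc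
  set d : E := (-I / 2 : ℂ) • (a - b) with hd
  have hca : c + I • d = a := by
    rw [hc, hd, smul_smul, show I * (-I / 2) = 1 / 2 by linear_combination (-1 / 2) * I_sq]
    module
  have hcb : c + (-I) • d = b := by
    rw [hc, hd, smul_smul, show -I * (-I / 2) = -1 / 2 by linear_combination (1 / 2) * I_sq]
    module
  let L : ℂ → E := fun t => c + t • d
  have hL : Differentiable ℂ L := by fun_prop
  have hLconj : Continuous fun t : ℂ => L ((starRingEnd ℂ) t) :=
    hL.continuous.comp Complex.continuous_conj
  let S : Set ℂ := {t | L t ∈ B ∧ L ((starRingEnd ℂ) t) ∈ B}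
  have hSo : IsOpen S := (hBo.preimage hL.continuous).inter (hBo.preimage hLconj)
  have hSc : Convex ℝ S := by
    rintro s ⟨hs, hs'⟩ t ⟨ht, ht'⟩ p q hp hq hpq
    have hLpq : ∀ s t : ℂ, L (p • s + q • t) = p • L s + q • L t := by
      intro s t
      have : c = p • c + q • c := by rw [← add_smul, hpq, one_smul]
      simp only [L, smul_add, add_smul, smul_assoc]
      nth_rewrite 1 [this]
      abel
    have hconj : (starRingEnd ℂ) (p • s + q • t)
        = p • (starRingEnd ℂ) s + q • (starRingEnd ℂ) t := by simp
    refine ⟨?_, ?_⟩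
    · rw [hLpq]
      exact hBc hs ht hp hq hpq
    · rw [hconj, hLpq]
      exact hBc hs' ht' hp hq hpq
  have hI : I ∈ S := by simp [S, L, -neg_smul, hca, hcb, ha, hb]
  have hnegI : -I ∈ S := by simp [S, L, -neg_smul, hca, hcb, ha, hb]
  have h0 : (0 : ℂ) ∈ S := by
    have := hSc hI hnegI (a := 1 / 2) (b := 1 / 2) (by norm_num) (by norm_num) (by norm_num)
    simpa using this
  let h : ℂ → ℂ := fun t =>
    ∑ j, ∑ i, u i j * f i (L t) * (starRingEnd ℂ) (g j (L ((starRingEnd ℂ) t)))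
  have hdiff : DifferentiableOn ℂ h S := by
    intro t ht
    refine DifferentiableAt.differentiableWithinAt ?_
    refine DifferentiableAt.fun_sum fun j _ => DifferentiableAt.fun_sum fun i _ => ?_
    have h₁ : DifferentiableAt ℂ (fun t => f i (L t)) t :=
      ((hf i).differentiableAt (hBo.mem_nhds ht.1)).comp t (hL t)
    have h₂ : DifferentiableAt ℂ (fun t => g j (L t)) ((starRingEnd ℂ) t) :=
      ((hg j).differentiableAt (hBo.mem_nhds ht.2)).comp _ (hL _)
    have h₃ := h₂.conj_conj
    rw [Complex.conj_conj] at h₃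
    exact (h₁.const_mul _).mul h₃
  have hzero := eqOn_zero_of_eq_zero_on_real hSo hSc h0 hdiff
    (fun t ht => by simpa [h] using hu _ ht.1) hI
  simpa [h, L, -neg_smul, hca, hcb] using hzero

/-- If (f₁,…,f_q) and (g₁,…,g_r) are linearly independent families of holomorphic
functions on 𝔹ⁿ and Σ_{ij} u_{ij} f_i(z) conj(g_j(z)) = 0 for all z ∈ 𝔹ⁿ, then
all u_{ij} = 0. -/
theorem holomorphic_antiholomorphic_independence
    (n : ℕ) (q r : ℕ) (hq : 0 < q) (hr : 0 < r)
    (f : Fin q → (Fin n → ℂ) → ℂ) (g : Fin r → (Fin n → ℂ) → ℂ)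
    (hf : ∀ i, DifferentiableOn ℂ (f i) (UnitBall n))
    (hg : ∀ j, DifferentiableOn ℂ (g j) (UnitBall n))
    (hlf : LinearIndependent ℂ (fun i : Fin q => (UnitBall n).restrict (f i)))
    (hlg : LinearIndependent ℂ (fun j : Fin r => (UnitBall n).restrict (g j)))
    (u : Matrix (Fin q) (Fin r) ℂ)
    (hu : ∀ z ∈ UnitBall n,
      ∑ j : Fin r, ∑ i : Fin q, u i j * f i z * (starRingEnd ℂ) (g j z) = 0) :
    ∀ i j, u i j = 0 := by
  have hpol : ∀ a ∈ UnitBall n, ∀ b ∈ UnitBall n,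
      ∑ j, ∑ i, u i j * f i a * (starRingEnd ℂ) (g j b) = 0 := fun a ha b hb =>
    polarization_eq_zero (isOpen_unitBall n) (convex_unitBall n) hf hg u hu ha hb
  rw [Fintype.linearIndependent_iff] at hlf hlg
  have hrow : ∀ b ∈ UnitBall n, ∀ i, ∑ j, u i j * (starRingEnd ℂ) (g j b) = 0 := by
    intro b hb
    refine hlf (fun i => ∑ j, u i j * (starRingEnd ℂ) (g j b)) ?_
    ext ⟨a, ha⟩
    simp only [Finset.sum_apply, Pi.smul_apply, smul_eq_mul, Finset.sum_mul,
      Pi.zero_apply]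
    rw [← hpol a ha b hb, Finset.sum_comm (s := Finset.univ (α := Fin r))]
    exact Finset.sum_congr rfl fun i _ => Finset.sum_congr rfl fun j _ =>
      mul_right_comm _ _ _
  intro i j
  have hconj := hlg (fun j => (starRingEnd ℂ) (u i j)) (by
    ext ⟨b, hb⟩
    have h := congrArg (starRingEnd ℂ) (hrow b hb i)
    simp only [map_sum, map_mul, Complex.conj_conj, map_zero] at h
    simp only [Finset.sum_apply, Pi.smul_apply, smul_eq_mul]
    exact h) j
  simpa using hconj
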